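/- For every integer d ≥ 2, one has (1 + 2^{−d} − 2^{−2d}) · ∏_{p odd prime} (1 + p^{−2d} − p^{−3d}) ≥ ζ(2d)/ζ(4d), where the product runs over all odd primes p and ζ is the Riemann zeta function. -/

import Mathlib

theorem Finset.one_sub_sum_le_prod_one_sub {ι : Type*} (s : Finset ι) (f : ι → ℝ)
    (h0 : ∀ i ∈ s, 0 ≤ f i) (h1 : ∀ i ∈ s, f i ≤ 1) :
    1 - ∑ i ∈ s, f i ≤ ∏ i ∈ s, (1 - f i) := by
  classical
  induction s using Finset.induction_on with
  | empty => simp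
  | insert a s ha ih =>
    rw [Finset.sum_insert ha, Finset.prod_insert ha]
    have hs := ih (fun i hi => h0 i (Finset.mem_insert_of_mem hi))
      (fun i hi => h1 i (Finset.mem_insert_of_mem hi))
    have ha0 := h0 a (Finset.mem_insert_self a s)
    have ha1 := h1 a (Finset.mem_insert_self a s)
    have hsum : 0 ≤ ∑ i ∈ s, f i :=
      Finset.sum_nonneg fun i hi => h0 i (Finset.mem_insert_of_mem hi)
    nlinarith [mul_le_mul_of_nonneg_left hs (sub_nonneg.2 ha1), mul_nonneg ha0 hsum]

theorem riemannZeta_natCast_re {k : ℕ} (hk : 1 < k) :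
    (riemannZeta (k : ℂ)).re = ∑' n : ℕ, 1 / (n : ℝ) ^ k := by
  rw [zeta_nat_eq_tsum_of_gt_one hk, ← Complex.ofReal_re (∑' n : ℕ, 1 / (n : ℝ) ^ k)]
  push_cast
  rfl

theorem one_le_riemannZeta_natCast_re {k : ℕ} (hk : 1 < k) :
    1 ≤ (riemannZeta (k : ℂ)).re := by
  rw [riemannZeta_natCast_re hk]
  simpa using (Real.summable_one_div_nat_pow.2 hk).le_tsum 1 fun n _ => by positivity

/-- The Euler product of the Riemann zeta function at a natural number, over the reals. -/
theorem hasProd_riemannZeta_natCast_re {k : ℕ} (hk : 1 < k) :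
    HasProd (fun p : Nat.Primes => (1 - 1 / ((p : ℕ) : ℝ) ^ k)⁻¹)
      (riemannZeta (k : ℂ)).re := by
  let f : ℕ →*₀ ℝ := invMonoidWithZeroHom.comp
    ((powMonoidWithZeroHom (by lia : k ≠ 0)).comp (Nat.castRingHom ℝ).toMonoidWithZeroHom)
  have hf (n : ℕ) : f n = 1 / (n : ℝ) ^ k := by simp [f, invMonoidWithZeroHom]
  have hsum : Summable (‖f ·‖) := by
    simpa only [hf] using (Real.summable_one_div_nat_pow.2 hk).norm
  rw [riemannZeta_natCast_re hk]
  simpa only [hf] using EulerProduct.eulerProduct_completely_multiplicative_hasProd hsum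

theorem hasProd_riemannZeta_ratio {k : ℕ} (hk : 1 < k) :
    HasProd (fun p : Nat.Primes => 1 + 1 / ((p : ℕ) : ℝ) ^ k)
      ((riemannZeta (k : ℂ)).re / (riemannZeta ((2 * k : ℕ) : ℂ)).re) := by
  have hk' : 1 < 2 * k := by lia
  refine ((hasProd_riemannZeta_natCast_re hk).div₀ (hasProd_riemannZeta_natCast_re hk')
    (by linarith [one_le_riemannZeta_natCast_re hk'])).congr_fun fun p => ?_
  have hp : (1 : ℝ) < ((p : ℕ) : ℝ) ^ k :=
    one_lt_pow₀ (by exact_mod_cast p.prop.one_lt) (by lia)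
  rw [mul_comm 2 k, pow_mul]
  generalize ((p : ℕ) : ℝ) ^ k = y at hp
  have h1 : y - 1 ≠ 0 := by linarith
  have h2 : y ^ 2 - 1 ≠ 0 := by nlinarith
  field_simp
  ring

theorem multipliable_one_add_one_div_pow_odd_primes {k : ℕ} (hk : 1 < k) :
    Multipliable fun p : {p : ℕ // p.Prime ∧ Odd p} => 1 + 1 / ((p : ℕ) : ℝ) ^ k :=
  Real.multipliable_one_add_of_summable
    ((Real.summable_one_div_nat_pow.2 hk).comp_injective Subtype.val_injective)

/-- Splitting off the Euler factor at `2`. -/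
theorem riemannZeta_ratio_eq_mul_tprod_odd_primes {k : ℕ} (hk : 1 < k) :
    (riemannZeta (k : ℂ)).re / (riemannZeta ((2 * k : ℕ) : ℂ)).re =
      (1 + 1 / (2 : ℝ) ^ k) *
        ∏' p : {p : ℕ // p.Prime ∧ Odd p}, (1 + 1 / ((p : ℕ) : ℝ) ^ k) := by
  let f : ℕ → ℝ := fun p => 1 + 1 / (p : ℝ) ^ k
  have htwo : HasProd (f ∘ ((↑) : ({2} : Set ℕ) → ℕ)) (1 + 1 / (2 : ℝ) ^ k) := by
    convert hasProd_unique (f ∘ ((↑) : ({2} : Set ℕ) → ℕ)) using 1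
    simp [f]
  have hodd : HasProd (f ∘ ((↑) : {p : ℕ | p.Prime ∧ Odd p} → ℕ))
      (∏' p : {p : ℕ // p.Prime ∧ Odd p}, (1 + 1 / ((p : ℕ) : ℝ) ^ k)) :=
    (multipliable_one_add_one_div_pow_odd_primes hk).hasProd
  have hdisj : Disjoint ({2} : Set ℕ) {p : ℕ | p.Prime ∧ Odd p} := by
    rw [Set.disjoint_singleton_left]
    rintro ⟨-, h⟩
    exact absurd h (by decide)
  have hunion : ({2} : Set ℕ) ∪ {p : ℕ | p.Prime ∧ Odd p} = {p : ℕ | p.Prime} := by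
    ext p
    constructor
    · rintro (rfl | h)
      · exact Nat.prime_two
      · exact h.1
    · intro h
      exact h.eq_two_or_odd'.imp id fun ho => ⟨h, ho⟩
  have hprod := htwo.mul_disjoint hdisj hodd
  rw [hunion] at hprod
  exact (hasProd_riemannZeta_ratio hk).unique hprod

theorem one_div_pow_three_mul_le {d n : ℕ} (hd : 2 ≤ d) (hn : 3 ≤ n) :
    1 / (n : ℝ) ^ (3 * d) ≤ 4 / 81 * (1 / 2 ^ d) * (1 / (n : ℝ) ^ 2) := by
  obtain ⟨e, rfl⟩ := Nat.exists_eq_add_of_le hd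
  have hn' : (3 : ℝ) ≤ n := by exact_mod_cast hn
  have h4 : (81 : ℝ) ≤ (n : ℝ) ^ 4 := by
    calc (81 : ℝ) = 3 ^ 4 := by norm_num
      _ ≤ _ := by gcongr
  have h3 : (2 : ℝ) ^ e ≤ ((n : ℝ) ^ 3) ^ e := by
    gcongr
    calc (2 : ℝ) ≤ 3 ^ 3 := by norm_num
      _ ≤ _ := by gcongr
  calc 1 / (n : ℝ) ^ (3 * (2 + e)) = 1 / ((n : ℝ) ^ 4 * ((n : ℝ) ^ 3) ^ e * (n : ℝ) ^ 2) := by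
        rw [← pow_mul]; ring
    _ ≤ 1 / (81 * 2 ^ e * (n : ℝ) ^ 2) := by gcongr
    _ = _ := by rw [pow_add]; field_simp; norm_num

theorem sum_one_div_pow_three_mul_odd_primes_le {d : ℕ} (hd : 2 ≤ d)
    (s : Finset {p : ℕ // p.Prime ∧ Odd p}) :
    ∑ p ∈ s, 1 / ((p : ℕ) : ℝ) ^ (3 * d) ≤ 1 / 8 * (1 / 2 ^ d) := by
  have hs : ∑ p ∈ s, 1 / ((p : ℕ) : ℝ) ^ 2 ≤ 2 := by
    calc ∑ p ∈ s, 1 / ((p : ℕ) : ℝ) ^ 2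
        = ∑ n ∈ s.map (Function.Embedding.subtype _), 1 / (n : ℝ) ^ 2 := by simp
      _ ≤ Real.pi ^ 2 / 6 := sum_le_hasSum _ (fun _ _ => by positivity) hasSum_zeta_two
      _ ≤ 2 := by nlinarith [Real.pi_lt_d2, Real.pi_pos]
  calc ∑ p ∈ s, 1 / ((p : ℕ) : ℝ) ^ (3 * d)
      ≤ ∑ p ∈ s, 4 / 81 * (1 / 2 ^ d) * (1 / ((p : ℕ) : ℝ) ^ 2) := by
        refine Finset.sum_le_sum fun p _ => one_div_pow_three_mul_le hd ?_
        have hodd := p.prop.2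
        have := p.prop.1.two_le
        grind
    _ = 4 / 81 * (1 / 2 ^ d) * ∑ p ∈ s, 1 / ((p : ℕ) : ℝ) ^ 2 := by rw [Finset.mul_sum]
    _ ≤ 4 / 81 * (1 / 2 ^ d) * 2 := by gcongr
    _ ≤ 1 / 8 * (1 / 2 ^ d) := by
        have : (0 : ℝ) < 1 / 2 ^ d := by positivity
        linarith

theorem one_sub_mul_tprod_odd_primes_le {d : ℕ} (hd : 2 ≤ d) :
    (1 - 1 / 8 * (1 / (2 : ℝ) ^ d)) *
        ∏' p : {p : ℕ // p.Prime ∧ Odd p}, (1 + 1 / ((p : ℕ) : ℝ) ^ (2 * d)) ≤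
      ∏' p : {p : ℕ // p.Prime ∧ Odd p},
        (1 + 1 / ((p : ℕ) : ℝ) ^ (2 * d) - 1 / ((p : ℕ) : ℝ) ^ (3 * d)) := by
  have hsummable {k : ℕ} (hk : 1 < k) :
      Summable fun p : {p : ℕ // p.Prime ∧ Odd p} => 1 / ((p : ℕ) : ℝ) ^ k :=
    (Real.summable_one_div_nat_pow.2 hk).comp_injective Subtype.val_injective
  have hlocal : Multipliable fun p : {p : ℕ // p.Prime ∧ Odd p} =>
      1 + 1 / ((p : ℕ) : ℝ) ^ (2 * d) - 1 / ((p : ℕ) : ℝ) ^ (3 * d) := by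
    simpa only [add_sub_assoc] using Real.multipliable_one_add_of_summable
      ((hsummable (by lia : 1 < 2 * d)).sub (hsummable (by lia : 1 < 3 * d)))
  have hB := (multipliable_one_add_one_div_pow_odd_primes (by lia : 1 < 2 * d)).hasProd
  refine le_of_tendsto_of_tendsto' (hB.const_mul _) hlocal.hasProd fun s => ?_
  have hle (p : {p : ℕ // p.Prime ∧ Odd p}) : 1 / ((p : ℕ) : ℝ) ^ (3 * d) ≤ 1 :=
    div_le_one_of_le₀ (one_le_pow₀ (by exact_mod_cast p.prop.1.one_le)) (by positivity)
  calc _ ≤ (∏ p ∈ s, (1 - 1 / ((p : ℕ) : ℝ) ^ (3 * d))) *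
        ∏ p ∈ s, (1 + 1 / ((p : ℕ) : ℝ) ^ (2 * d)) := by
        refine mul_le_mul_of_nonneg_right ?_ (Finset.prod_nonneg fun p _ => by positivity)
        linarith [sum_one_div_pow_three_mul_odd_primes_le hd s,
          s.one_sub_sum_le_prod_one_sub (fun p => 1 / ((p : ℕ) : ℝ) ^ (3 * d))
            (fun p _ => by positivity) fun p _ => hle p]
    _ = ∏ p ∈ s, (1 - 1 / ((p : ℕ) : ℝ) ^ (3 * d)) * (1 + 1 / ((p : ℕ) : ℝ) ^ (2 * d)) :=
        Finset.prod_mul_distrib.symm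
    _ ≤ _ := by
        refine Finset.prod_le_prod
          (fun p _ => mul_nonneg (sub_nonneg.2 (hle p)) (by positivity)) fun p _ => ?_
        have : 0 ≤ 1 / ((p : ℕ) : ℝ) ^ (3 * d) * (1 / ((p : ℕ) : ℝ) ^ (2 * d)) := by positivity
        linarith

/-- For every integer `d ≥ 2`, one has
`(1 + 2^{-d} - 2^{-2d}) · ∏_{p odd prime} (1 + p^{-2d} - p^{-3d}) ≥ ζ(2d)/ζ(4d)`,
where `ζ` is the Riemann zeta function (real-valued at the real arguments `2d, 4d > 1`). -/
theorem local_average_product_ge_zeta_ratio (d : ℕ) (hd : 2 ≤ d) :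
    (riemannZeta ((2 * d : ℕ) : ℂ)).re / (riemannZeta ((4 * d : ℕ) : ℂ)).re ≤
      (1 + 1 / (2 : ℝ) ^ d - 1 / (2 : ℝ) ^ (2 * d)) *
        ∏' p : {p : ℕ // p.Prime ∧ Odd p},
          (1 + 1 / (((p : ℕ) : ℝ) ^ (2 * d)) - 1 / (((p : ℕ) : ℝ) ^ (3 * d))) := by
  have hB : 0 ≤ ∏' p : {p : ℕ // p.Prime ∧ Odd p}, (1 + 1 / ((p : ℕ) : ℝ) ^ (2 * d)) :=
    ge_of_tendsto' (multipliable_one_add_one_div_pow_odd_primes (by lia : 1 < 2 * d)).hasProd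
      fun s => Finset.prod_nonneg fun p _ => by positivity
  have hx0 : (0 : ℝ) < 1 / 2 ^ d := by positivity
  have hx : 1 / (2 : ℝ) ^ d ≤ 1 / 4 := by
    gcongr
    calc (4 : ℝ) = 2 ^ 2 := by norm_num
      _ ≤ 2 ^ d := by gcongr; norm_num
  have hsq : 1 / (2 : ℝ) ^ (2 * d) = (1 / 2 ^ d) ^ 2 := by rw [div_pow, ← pow_mul]; ring
  rw [(by ring : 4 * d = 2 * (2 * d)),
    riemannZeta_ratio_eq_mul_tprod_odd_primes (by lia : 1 < 2 * d), hsq]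
  have hA := one_sub_mul_tprod_odd_primes_le hd
  generalize 1 / (2 : ℝ) ^ d = x at *
  refine le_trans ?_ (mul_le_mul_of_nonneg_left hA (by nlinarith))
  rw [← mul_assoc]
  refine mul_le_mul_of_nonneg_right ?_ hB
  nlinarith [mul_nonneg hx0.le (sub_nonneg.2 hx), pow_pos hx0 3]
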